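/- Every R1 refutation of Ω′_n = EPR(Ω_n) ∪ {p(f₁), ¬p(f₀)} has size superpolynomial in n: for every polynomial q, for all sufficiently large n, every R1 refutation of Ω′_n has size greater than q(n). -/

import Mathlib

/-! ## Propositional / QBF side -/

inductive Lit where
  | pos (x : ℕ)
  | neg (x : ℕ)
deriving DecidableEq

def Lit.var : Lit → ℕ
  | pos x => x
  | neg x => x

def Lit.isPos : Lit → Bool
  | pos _ => true
  | neg _ => false

def Lit.negate : Lit → Lit
  | pos x => neg x
  | neg x => pos x

def Lit.eval (v : ℕ → Bool) : Lit → Bool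
  | pos x => v x
  | neg x => !(v x)

abbrev Clause := Finset Lit

def Clause.Taut (C : Clause) : Prop := ∃ x, Lit.pos x ∈ C ∧ Lit.neg x ∈ C

/-- A prenex CNF: a list of quantifier blocks (`true` = existential,
`false` = universal), each with an ordered list of variables, and a matrix
which is a finite set of clauses. -/
structure PCNF where
  blocks : List (Bool × List ℕ)
  matrix : Finset Clause

def PCNF.allVars (Φ : PCNF) : List ℕ := Φ.blocks.flatMap (·.2)

/-- Well-formedness: quantifier blocks alternate and the blocks are
pairwise disjoint sets of variables (no repetitions). -/
def PCNF.WF (Φ : PCNF) : Prop :=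
  List.Chain' (fun a b => a.1 ≠ b.1) Φ.blocks ∧ Φ.allVars.Nodup ∧
    ∀ b ∈ Φ.blocks, b.2 ≠ []

/-- Closedness: every variable of the matrix is quantified in the prefix. -/
def PCNF.Closed (Φ : PCNF) : Prop :=
  ∀ C ∈ Φ.matrix, ∀ l ∈ C, l.var ∈ Φ.allVars

def PCNF.existB (Φ : PCNF) (x : ℕ) : Bool :=
  Φ.blocks.any fun b => b.1 && b.2.contains x

def PCNF.univB (Φ : PCNF) (x : ℕ) : Bool :=
  Φ.blocks.any fun b => !b.1 && b.2.contains x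

/-- The level of a variable: the index of its quantifier block. -/
def PCNF.lv (Φ : PCNF) (x : ℕ) : ℕ :=
  Φ.blocks.findIdx fun b => b.2.contains x

def evalClause (v : ℕ → Bool) (C : Clause) : Prop := ∃ l ∈ C, l.eval v = true

/-- Standard QBF semantics of a prenex CNF, evaluated block by block. -/
def truthAux (M : Finset Clause) : List (Bool × List ℕ) → (ℕ → Bool) → Prop
  | [], v => ∀ C ∈ M, evalClause v C
  | (q, xs) :: rest, v =>
      if q then ∃ w : ℕ → Bool, (∀ y, y ∉ xs → w y = v y) ∧ truthAux M rest w
      else ∀ w : ℕ → Bool, (∀ y, y ∉ xs → w y = v y) → truthAux M rest w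

def PCNF.IsTrue (Φ : PCNF) : Prop := truthAux Φ.matrix Φ.blocks fun _ => false

/-! ## Q-resolution and QU-resolution -/

/-- One derivation step of Q-res (`univPivot = false`) resp. QU-res
(`univPivot = true`) from the clauses derived so far. -/
inductive QStep (Φ : PCNF) (univPivot : Bool) (prev : List Clause) : Clause → Prop
  | ax (C : Clause) (hC : C ∈ Φ.matrix) (hnt : ¬ C.Taut) : QStep Φ univPivot prev C
  | res (x : ℕ) (A B : Clause) (hA : A ∈ prev) (hB : B ∈ prev)
      (hxa : Lit.pos x ∈ A) (hxb : Lit.neg x ∈ B)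
      (hpiv : Φ.existB x = true ∨ (univPivot = true ∧ Φ.univB x = true))
      (hblock : ∀ l ∈ A.erase (Lit.pos x), l.negate ∉ B.erase (Lit.neg x)) :
      QStep Φ univPivot prev ((A.erase (Lit.pos x)) ∪ (B.erase (Lit.neg x)))
  | fac (A : Clause) (hA : A ∈ prev) : QStep Φ univPivot prev A
  | univRed (A : Clause) (m : Lit) (hA : A ∈ prev) (hm : m ∈ A)
      (hu : Φ.univB m.var = true)
      (hlv : ∀ l ∈ A.erase m, Φ.existB l.var = true → Φ.lv l.var < Φ.lv m.var) :
      QStep Φ univPivot prev (A.erase m)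

def QValid (Φ : PCNF) (univPivot : Bool) (π : List Clause) : Prop :=
  ∀ i < π.length, QStep Φ univPivot (π.take i) π[i]!

def QRefutation (Φ : PCNF) (univPivot : Bool) (π : List Clause) : Prop :=
  QValid Φ univPivot π ∧ π ≠ [] ∧ π.getLast! = (∅ : Clause)

/-- Size of a (QBF) resolution derivation: total number of literal
occurrences in its clauses. -/
def qSize (π : List Clause) : ℕ := (π.map Finset.card).sum

/-! ## First-order terms, atoms, literals, clauses -/

inductive FTerm where
  | var (x : ℕ)
  | app (f : ℕ) (args : List FTerm)

noncomputable instance : DecidableEq FTerm := Classical.decEq _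

def FTerm.subst (σ : ℕ → FTerm) : FTerm → FTerm
  | .var x => σ x
  | .app f args => .app f (args.attach.map fun t => t.1.subst σ)
decreasing_by
  have := List.sizeOf_lt_of_mem t.2
  simp only [FTerm.app.sizeOf_spec]; omega

def FTerm.symSize : FTerm → ℕ
  | .var _ => 1
  | .app _ args => 1 + (args.attach.map fun t => t.1.symSize).sum
decreasing_by
  have := List.sizeOf_lt_of_mem t.2
  simp only [FTerm.app.sizeOf_spec]; omega

def FTerm.vars : FTerm → Finset ℕ
  | .var x => {x}
  | .app _ args => (args.attach.map fun t => t.1.vars).foldr (· ∪ ·) ∅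
decreasing_by
  have := List.sizeOf_lt_of_mem t.2
  simp only [FTerm.app.sizeOf_spec]; omega

/-- An atom `p(t₁,…,t_k)`: predicate symbol together with argument list. -/
structure FAtom where
  p : ℕ
  args : List FTerm

noncomputable instance : DecidableEq FAtom := Classical.decEq _

def FAtom.subst (σ : ℕ → FTerm) (a : FAtom) : FAtom := ⟨a.p, a.args.map (FTerm.subst σ)⟩
def FAtom.symSize (a : FAtom) : ℕ := 1 + (a.args.map FTerm.symSize).sum
def FAtom.vars (a : FAtom) : Finset ℕ := (a.args.map FTerm.vars).foldr (· ∪ ·) ∅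

inductive FLit where
  | pos (a : FAtom)
  | neg (a : FAtom)

noncomputable instance : DecidableEq FLit := Classical.decEq _

def FLit.atom : FLit → FAtom
  | pos a => a
  | neg a => a

def FLit.isPos : FLit → Bool
  | pos _ => true
  | neg _ => false

def FLit.subst (σ : ℕ → FTerm) : FLit → FLit
  | pos a => pos (a.subst σ)
  | neg a => neg (a.subst σ)

def FLit.symSize (l : FLit) : ℕ :=
  match l with
  | .pos a => a.symSize
  | .neg a => 1 + a.symSize

abbrev FClause := Finset FLit

noncomputable def FClause.subst (σ : ℕ → FTerm) (C : FClause) : FClause :=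
  C.image (FLit.subst σ)

noncomputable def FClause.symSize (C : FClause) : ℕ := ∑ l ∈ C, l.symSize

noncomputable def FClause.fvars (C : FClause) : Finset ℕ := C.sup fun l => l.atom.vars

/-! ## First-order resolution R1 -/

def compSub (σ μ : ℕ → FTerm) : ℕ → FTerm := fun x => (σ x).subst μ

def Unifies (σ : ℕ → FTerm) (a b : FAtom) : Prop := a.subst σ = b.subst σ

def IsMGU (σ : ℕ → FTerm) (a b : FAtom) : Prop :=
  Unifies σ a b ∧ ∀ τ, Unifies τ a b → ∃ μ, ∀ x, compSub σ μ x = τ x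

/-- `D` is a factor of `C`: `D = Cσ` for `σ` an mgu of two distinct
same-sign literals of `C`. -/
def IsFactor (C D : FClause) : Prop :=
  ∃ K L σ, K ∈ C ∧ L ∈ C ∧ K ≠ L ∧ K.isPos = L.isPos ∧
    IsMGU σ K.atom L.atom ∧ D = C.subst σ

def renameSub (ρ : ℕ → ℕ) : ℕ → FTerm := fun x => .var (ρ x)

/-- `E` is a resolvent of `C` and `D`. -/
def IsResolvent (C D E : FClause) : Prop :=
  ∃ ρ : ℕ → ℕ, Function.Injective ρ ∧
    ∃ K L σ, Disjoint C.fvars (FClause.subst (renameSub ρ) D).fvars ∧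
      K ∈ C ∧ L ∈ FClause.subst (renameSub ρ) D ∧ K.isPos = !L.isPos ∧
      IsMGU σ K.atom L.atom ∧
      E = ((C.subst σ).erase (K.subst σ)) ∪
          (((FClause.subst (renameSub ρ) D).subst σ).erase (L.subst σ))

def R1Valid (S : Set FClause) (π : List FClause) : Prop :=
  ∀ i < π.length,
    π[i]! ∈ S ∨ (∃ j < i, IsFactor π[j]! π[i]!) ∨
      (∃ j < i, ∃ k < i, IsResolvent π[j]! π[k]! π[i]!)

def R1Refutation (S : Set FClause) (π : List FClause) : Prop :=
  R1Valid S π ∧ π ≠ [] ∧ π.getLast! = (∅ : FClause)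

noncomputable def r1Size (π : List FClause) : ℕ := (π.map FClause.symSize).sum

/-- Tree-form R1 refutations: every clause occurrence is used at most once
as a premise, which is inherent in a tree-structured derivation. -/
inductive R1Tree (S : Set FClause) : FClause → Type
  | input (C : FClause) (h : C ∈ S) : R1Tree S C
  | factor {C : FClause} (t : R1Tree S C) (D : FClause) (h : IsFactor C D) : R1Tree S D
  | resolve {C D : FClause} (t₁ : R1Tree S C) (t₂ : R1Tree S D) (E : FClause)
      (h : IsResolvent C D E) : R1Tree S E

noncomputable def R1Tree.size {S : Set FClause} : {C : FClause} → R1Tree S C → ℕ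
  | C, .input _ _ => C.symSize
  | D, .factor t _ _ => t.size + D.symSize
  | E, .resolve t₁ t₂ _ _ => t₁.size + t₂.size + E.symSize

def R1Tree.clauseCount {S : Set FClause} : {C : FClause} → R1Tree S C → ℕ
  | _, .input _ _ => 1
  | _, .factor t _ _ => t.clauseCount + 1
  | _, .resolve t₁ t₂ _ _ => t₁.clauseCount + t₂.clauseCount + 1

/-! ## The Skolem and EPR translations -/

/-- The universal variables strictly preceding `a` in the prefix,
in prefix order. -/
def PCNF.univBefore (Φ : PCNF) (a : ℕ) : List ℕ :=
  ((Φ.blocks.flatMap fun b => b.2.map fun x => (b.1, x)).takeWhile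
      fun p => p.2 ≠ a).filterMap
    fun p => if p.1 = false then some p.2 else none

/-- `p` is the predicate symbol `0`; `f₀`, `f₁` are the constants `0`, `1`;
the Skolem function symbol for existential variable `a` is `a + 2`. -/
def skAtom (Φ : PCNF) (x : ℕ) : FAtom :=
  if Φ.existB x then ⟨0, [FTerm.app (x + 2) ((Φ.univBefore x).map FTerm.var)]⟩
  else ⟨0, [FTerm.var x]⟩

def skLit (Φ : PCNF) : Lit → FLit
  | .pos x => .pos (skAtom Φ x)
  | .neg x => .neg (skAtom Φ x)

noncomputable def skClause (Φ : PCNF) (C : Clause) : FClause := C.image (skLit Φ)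

def pf1Cl : FClause := {FLit.pos ⟨0, [FTerm.app 1 []]⟩}
def npf0Cl : FClause := {FLit.neg ⟨0, [FTerm.app 0 []]⟩}

/-- The clause set `Sk(Φ) ∪ {p(f₁), ¬p(f₀)}`. -/
noncomputable def skSet (Φ : PCNF) : Set FClause :=
  ↑(Φ.matrix.image (skClause Φ)) ∪ {pf1Cl, npf0Cl}

/-- EPR atom: `p(f_a(u₁,…,u_k))` with `k ≥ 1` becomes `p_a(u₁,…,u_k)`,
where the fresh predicate symbol `p_a` is `a + 1`. -/
def eprAtom (Φ : PCNF) (x : ℕ) : FAtom :=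
  if Φ.existB x then
    if Φ.univBefore x = [] then ⟨0, [FTerm.app (x + 2) []]⟩
    else ⟨x + 1, (Φ.univBefore x).map FTerm.var⟩
  else ⟨0, [FTerm.var x]⟩

def eprLit (Φ : PCNF) : Lit → FLit
  | .pos x => .pos (eprAtom Φ x)
  | .neg x => .neg (eprAtom Φ x)

noncomputable def eprClause (Φ : PCNF) (C : Clause) : FClause := C.image (eprLit Φ)

/-- The clause set `EPR(Φ) ∪ {p(f₁), ¬p(f₀)}`. -/
noncomputable def eprSet (Φ : PCNF) : Set FClause :=
  ↑(Φ.matrix.image (eprClause Φ)) ∪ {pf1Cl, npf0Cl}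

/-! ## IR-calc and its extensions -/

/-- An annotation: a (functional) finite set of assignments
`universal variable ↦ 0/1` (`false` = 0, `true` = 1). -/
abbrev Ann := Finset (ℕ × Bool)

def Ann.Functional (τ : Ann) : Prop := ∀ x b b', (x, b) ∈ τ → (x, b') ∈ τ → b = b'

/-- Restriction `[σ]` of an annotation to the universal variables of level
below the level of the literal `l`. -/
def annRestr (Φ : PCNF) (σ : Ann) (l : Lit) : Ann :=
  σ.filter fun p => Φ.lv p.1 < Φ.lv l.var

/-- Completion of `μ` by `τ`. -/
def annCompl (μ τ : Ann) : Ann :=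
  μ ∪ τ.filter fun p => p.1 ∉ μ.image Prod.fst

structure ALit where
  lit : Lit
  ann : Ann
deriving DecidableEq

abbrev AClause := Finset ALit

def ALit.symSize (al : ALit) : ℕ := 1 + 2 * al.ann.card
def AClause.symSize (A : AClause) : ℕ := ∑ al ∈ A, al.symSize
def aSize (π : List AClause) : ℕ := (π.map AClause.symSize).sum

/-- The annotation extracted from the universal literals of a clause:
`u ↦ 0` for positive and `u ↦ 1` for negative universal literals. -/
def axAnn (Φ : PCNF) (C : Clause) : Ann :=
  (C.filter fun l => Φ.univB l.var).image fun l =>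
    match l with
    | .pos u => (u, false)
    | .neg u => (u, true)

/-- The axiom clause of IR-calc obtained from a matrix clause. -/
def axClause (Φ : PCNF) (C : Clause) : AClause :=
  (C.filter fun l => Φ.existB l.var).image fun l => ⟨l, annRestr Φ (axAnn Φ C) l⟩

/-- Application of a variable substitution `σ_v` (universal ↦ existential)
to a literal. -/
def applySigv (σv : ℕ → Option ℕ) : Lit → Lit
  | .pos x => match σv x with | some e => .pos e | none => .pos x
  | .neg x => match σv x with | some e => .neg e | none => .neg x

def Clause.applySigv (σv : ℕ → Option ℕ) (C : Clause) : Clause :=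
  C.image (_root_.applySigv σv)

/-- Admissibility of `σ_v`: it maps universal variables to existential
variables of strictly smaller level. -/
def Admissible (Φ : PCNF) (σv : ℕ → Option ℕ) : Prop :=
  ∀ x e, σv x = some e → Φ.univB x = true ∧ Φ.existB e = true ∧ Φ.lv e < Φ.lv x

/-- One step of IR-calc(P, M, Δ, σ_v).  Plain IR-calc is the instance with
`Δ = ∅` and `σv = fun _ => none`; IR-calc^{σ_v} the instance with `Δ = ∅`. -/
inductive IRStep (Φ : PCNF) (Δ : Finset Clause) (σv : ℕ → Option ℕ)
    (prev : List AClause) : AClause → Prop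
  | ax (C : Clause) (hC : C ∈ Φ.matrix) (hnt : ¬ C.Taut)
      (hnt' : ¬ (C.applySigv σv).Taut) :
      IRStep Φ Δ σv prev (axClause Φ (C.applySigv σv))
  | axExt (C : Clause) (hC : C ∈ Δ) (hnt : ¬ C.Taut) :
      IRStep Φ Δ σv prev (C.image fun l => ⟨l, ∅⟩)
  | res (x : ℕ) (τ : Ann) (A B : AClause) (hA : A ∈ prev) (hB : B ∈ prev)
      (hxa : (⟨Lit.pos x, τ⟩ : ALit) ∈ A) (hxb : (⟨Lit.neg x, τ⟩ : ALit) ∈ B) :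
      IRStep Φ Δ σv prev ((A.erase ⟨Lit.pos x, τ⟩) ∪ (B.erase ⟨Lit.neg x, τ⟩))
  | fac (A : AClause) (hA : A ∈ prev) : IRStep Φ Δ σv prev A
  | inst (A : AClause) (τ : Ann) (hA : A ∈ prev) (hfun : τ.Functional)
      (hdom : ∀ p ∈ τ, Φ.univB p.1 = true) :
      IRStep Φ Δ σv prev
        (A.image fun al => ⟨al.lit, annRestr Φ (annCompl al.ann τ) al.lit⟩)

def IRValid (Φ : PCNF) (Δ : Finset Clause) (σv : ℕ → Option ℕ)
    (π : List AClause) : Prop :=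
  ∀ i < π.length, IRStep Φ Δ σv (π.take i) π[i]!

def IRRefutation (Φ : PCNF) (Δ : Finset Clause) (σv : ℕ → Option ℕ)
    (π : List AClause) : Prop :=
  IRValid Φ Δ σv π ∧ π ≠ [] ∧ π.getLast! = (∅ : AClause)

def noSub : ℕ → Option ℕ := fun _ => none

/-- Tree-form IR-calc(P, M, Δ, σ_v) derivations. -/
inductive IRTree (Φ : PCNF) (Δ : Finset Clause) (σv : ℕ → Option ℕ) : AClause → Type
  | ax (C : Clause) (hC : C ∈ Φ.matrix) (hnt : ¬ C.Taut)
      (hnt' : ¬ (C.applySigv σv).Taut) : IRTree Φ Δ σv (axClause Φ (C.applySigv σv))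
  | axExt (C : Clause) (hC : C ∈ Δ) (hnt : ¬ C.Taut) :
      IRTree Φ Δ σv (C.image fun l => ⟨l, ∅⟩)
  | res {A B : AClause} (t₁ : IRTree Φ Δ σv A) (t₂ : IRTree Φ Δ σv B)
      (x : ℕ) (τ : Ann)
      (hxa : (⟨Lit.pos x, τ⟩ : ALit) ∈ A) (hxb : (⟨Lit.neg x, τ⟩ : ALit) ∈ B) :
      IRTree Φ Δ σv ((A.erase ⟨Lit.pos x, τ⟩) ∪ (B.erase ⟨Lit.neg x, τ⟩))
  | inst {A : AClause} (t : IRTree Φ Δ σv A) (τ : Ann) (hfun : τ.Functional)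
      (hdom : ∀ p ∈ τ, Φ.univB p.1 = true) :
      IRTree Φ Δ σv (A.image fun al => ⟨al.lit, annRestr Φ (annCompl al.ann τ) al.lit⟩)

def IRTree.size {Φ : PCNF} {Δ : Finset Clause} {σv : ℕ → Option ℕ} :
    {A : AClause} → IRTree Φ Δ σv A → ℕ
  | _, .ax C _ _ _ => AClause.symSize (axClause Φ (C.applySigv σv))
  | _, .axExt C _ _ => AClause.symSize (C.image fun l => (⟨l, ∅⟩ : ALit))
  | _, .res (A := A) (B := B) t₁ t₂ x τ _ _ =>
      t₁.size + t₂.size +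
        AClause.symSize ((A.erase ⟨Lit.pos x, τ⟩) ∪ (B.erase ⟨Lit.neg x, τ⟩))
  | _, .inst (A := A) t τ _ _ =>
      t.size + AClause.symSize (A.image fun al =>
        (⟨al.lit, annRestr Φ (annCompl al.ann τ) al.lit⟩ : ALit))

/-! ## The formula families Φ_n and Ω_n (pigeonhole based) -/

def xv (i j : ℕ) : ℕ := Nat.pair 0 (Nat.pair i (Nat.pair j 0))
def yv (i j : ℕ) : ℕ := Nat.pair 1 (Nat.pair i (Nat.pair j 0))
def zv (i₁ i₂ j : ℕ) : ℕ := Nat.pair 2 (Nat.pair i₁ (Nat.pair i₂ j))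

def Xlist (n : ℕ) : List ℕ :=
  (List.range (n+1)).flatMap fun i => (List.range n).map fun j => xv (i+1) (j+1)
def Ylist (n : ℕ) : List ℕ :=
  (List.range (n+1)).flatMap fun i => (List.range n).map fun j => yv (i+1) (j+1)
def Zlist (n : ℕ) : List ℕ :=
  ((List.range (n+1)).map fun i => zv (i+1) 0 0) ++
  ((List.range n).flatMap fun j => (List.range (n+1)).flatMap fun i₁ =>
    (List.range (n+1)).filterMap fun i₂ =>
      if i₁ < i₂ then some (zv (i₁+1) (i₂+1) (j+1)) else none)

/-- The clauses of PHP_n(X_n). -/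
def PHPcls (n : ℕ) : Finset Clause :=
  ((List.range (n+1)).map fun i =>
      (((List.range n).map fun j => Lit.pos (xv (i+1) (j+1))).toFinset : Clause)).toFinset ∪
  ((List.range n).flatMap fun j => (List.range (n+1)).flatMap fun i₁ =>
    (List.range (n+1)).filterMap fun i₂ =>
      if i₁ < i₂ then
        some ({Lit.neg (xv (i₁+1) (j+1)), Lit.neg (xv (i₂+1) (j+1))} : Clause)
      else none).toFinset

/-- The clauses of TPHP′_n(Y_n, Z_n). -/
def TPHPcls (n : ℕ) : Finset Clause :=
  {(((Zlist n).map Lit.neg).toFinset : Clause)} ∪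
  ((List.range (n+1)).flatMap fun i => (List.range n).map fun j =>
      ({Lit.pos (zv (i+1) 0 0), Lit.neg (yv (i+1) (j+1))} : Clause)).toFinset ∪
  ((List.range n).flatMap fun j => (List.range (n+1)).flatMap fun i₁ =>
    (List.range (n+1)).flatMap fun i₂ =>
      if i₁ < i₂ then
        [({Lit.pos (zv (i₁+1) (i₂+1) (j+1)), Lit.pos (yv (i₁+1) (j+1))} : Clause),
         ({Lit.pos (zv (i₁+1) (i₂+1) (j+1)), Lit.pos (yv (i₂+1) (j+1))} : Clause)]
      else []).toFinset

def phiMatrix (n : ℕ) : Finset Clause := TPHPcls n ∪ PHPcls n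

/-- Φ_n = ∃X_n ∀Y_n ∃Z_n (TPHP′_n ∧ PHP_n). -/
def PhiF (n : ℕ) : PCNF :=
  ⟨[(true, Xlist n), (false, Ylist n), (true, Zlist n)], phiMatrix n⟩

/-- Ω_n = ∀Y_n ∃Z_n ∃X_n (TPHP′_n ∧ PHP_n) (Z_n and X_n form one block). -/
def OmegaF (n : ℕ) : PCNF :=
  ⟨[(false, Ylist n), (true, Zlist n ++ Xlist n)], phiMatrix n⟩

/-! ## The formula family Ψ_t of Kleine Büning, Karpinski and Flögel -/

def dv (j : ℕ) : ℕ := 5*j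
def ev (j : ℕ) : ℕ := 5*j+1
def xvv (j : ℕ) : ℕ := 5*j+2
def fv (j : ℕ) : ℕ := 5*j+3
def qv (j : ℕ) : ℕ := 5*j+4

/-- The prefix P_t; if `withQ` is set, the fresh extension variable `q_i`
is placed in the same existential block as `d_i` and `e_i`. -/
def psiPrefix (t : ℕ) (withQ : Bool) : List (Bool × List ℕ) :=
  ((true, [dv 0, dv 1, ev 1] ++ if withQ then [qv 1] else []) ::
    (List.range (t-1)).flatMap fun j =>
      [(false, [xvv (j+1)]),
       (true, [dv (j+2), ev (j+2)] ++ if withQ then [qv (j+2)] else [])]) ++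
  [(false, [xvv t]), (true, (List.range t).map fun i => fv (i+1))]

def fNegs (t : ℕ) : List Lit := (List.range t).map fun i => Lit.neg (fv (i+1))

def psiMatrix (t : ℕ) : Finset Clause :=
  ({({Lit.neg (dv 0)} : Clause),
    ({Lit.pos (dv 0), Lit.neg (dv 1), Lit.neg (ev 1)} : Clause),
    (((Lit.pos (dv t) :: Lit.neg (xvv t) :: fNegs t).toFinset : Clause)),
    (((Lit.pos (ev t) :: Lit.pos (xvv t) :: fNegs t).toFinset : Clause))} : Finset Clause) ∪
  ((List.range (t-1)).flatMap fun j =>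
     [({Lit.pos (dv (j+1)), Lit.neg (xvv (j+1)), Lit.neg (dv (j+2)), Lit.neg (ev (j+2))} : Clause),
      ({Lit.pos (ev (j+1)), Lit.pos (xvv (j+1)), Lit.neg (dv (j+2)), Lit.neg (ev (j+2))} : Clause)]).toFinset ∪
  ((List.range t).flatMap fun j =>
     [({Lit.neg (xvv (j+1)), Lit.pos (fv (j+1))} : Clause),
      ({Lit.pos (xvv (j+1)), Lit.pos (fv (j+1))} : Clause)]).toFinset

def PsiF (t : ℕ) : PCNF := ⟨psiPrefix t false, psiMatrix t⟩

/-- Ψ_t with the extension variables q_i added to the prefix. -/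
def PsiFq (t : ℕ) : PCNF := ⟨psiPrefix t true, psiMatrix t⟩

/-- The extension clauses Δ: clausal form of q_i ↔ (¬d_i ∧ e_i), 1 ≤ i ≤ t. -/
def DeltaT (t : ℕ) : Finset Clause :=
  ((List.range t).flatMap fun i =>
    [({Lit.pos (qv (i+1)), Lit.pos (dv (i+1)), Lit.neg (ev (i+1))} : Clause),
     ({Lit.neg (qv (i+1)), Lit.neg (dv (i+1))} : Clause),
     ({Lit.neg (qv (i+1)), Lit.pos (ev (i+1))} : Clause)]).toFinset

/-- σ_{v,t} = { x_i ↦ q_i : 1 ≤ i ≤ t }. -/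
def sigmaQv (t : ℕ) : ℕ → Option ℕ := fun v =>
  if v % 5 = 2 ∧ 1 ≤ v / 5 ∧ v / 5 ≤ t then some (5 * (v / 5) + 4) else none

/-- σ_{v,t} = { x_i ↦ e_i : 1 ≤ i ≤ t }. -/
def sigmaEv (t : ℕ) : ℕ → Option ℕ := fun v =>
  if v % 5 = 2 ∧ 1 ≤ v / 5 ∧ v / 5 ≤ t then some (5 * (v / 5) + 1) else none

/-! ## The combinatorial lower bound (Haken's theorem, after Beame and Pitassi) -/

namespace HakenPHP

/-- A critical assignment `f` (hole `j` holds pigeon `f j`) satisfies the monotone clause `M`. -/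
def MSat {n : ℕ} (f : Fin n → Fin (n+1)) (M : Finset (Fin (n+1) × Fin n)) : Prop :=
  ∃ j, (f j, j) ∈ M

/-- `f` is a critical assignment agreeing with `r` off the set `H` of free holes. -/
def Ext {n : ℕ} (H : Finset (Fin n)) (r f : Fin n → Fin (n+1)) : Prop :=
  Function.Injective f ∧ ∀ j, j ∉ H → f j = r j

open Classical in
/-- The free pigeons. -/
noncomputable def Pig {n : ℕ} (H : Finset (Fin n)) (r : Fin n → Fin (n+1)) : Finset (Fin (n+1)) :=
  Finset.univ \ (Hᶜ.image r)

lemma mem_Pig {n : ℕ} {H : Finset (Fin n)} {r : Fin n → Fin (n+1)} {i : Fin (n+1)} :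
    i ∈ Pig H r ↔ ∀ j, j ∉ H → r j ≠ i := by
  simp [Pig]

lemma card_Pig {n : ℕ} {H : Finset (Fin n)} {r : Fin n → Fin (n+1)} (hr : Function.Injective r) :
    (Pig H r).card + Hᶜ.card = n + 1 := by
  classical
  unfold Pig
  rw [← Finset.compl_eq_univ_sdiff, ← Finset.card_image_of_injective Hᶜ hr]
  have := Finset.card_compl_add_card (Hᶜ.image r)
  rw [this, Fintype.card_fin]

open Classical in
/-- The pigeons `i` such that some `i`-critical assignment falsifies `M`. -/
noncomputable def Wt {n : ℕ} (H : Finset (Fin n)) (r : Fin n → Fin (n+1))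
    (M : Finset (Fin (n+1) × Fin n)) : Finset (Fin (n+1)) :=
  Finset.univ.filter fun i => ∃ f, Ext H r f ∧ (∀ j, f j ≠ i) ∧ ¬ MSat f M

lemma mem_Wt {n : ℕ} {H : Finset (Fin n)} {r : Fin n → Fin (n+1)}
    {M : Finset (Fin (n+1) × Fin n)} {i : Fin (n+1)} :
    i ∈ Wt H r M ↔ ∃ f, Ext H r f ∧ (∀ j, f j ≠ i) ∧ ¬ MSat f M := by
  simp [Wt]

lemma Wt_subset {n : ℕ} {H : Finset (Fin n)} {r : Fin n → Fin (n+1)}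
    {M : Finset (Fin (n+1) × Fin n)} : Wt H r M ⊆ Pig H r := by
  intro i hi
  obtain ⟨f, hf, hm, -⟩ := mem_Wt.1 hi
  rw [mem_Pig]
  intro j hj h
  exact hm j ((hf.2 j hj).trans h)

lemma exists_missing {n : ℕ} (f : Fin n → Fin (n+1)) : ∃ i, ∀ j, f j ≠ i := by
  by_contra h
  push Not at h
  have := Fintype.card_le_of_surjective f h
  simp at this

lemma missing_unique {n : ℕ} {f : Fin n → Fin (n+1)} (hf : Function.Injective f)
    {i k : Fin (n+1)} (hi : ∀ j, f j ≠ i) (hk : k ≠ i) : ∃ j, f j = k := by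
  classical
  by_contra h
  push Not at h
  have h1 : (Finset.univ.image f) ⊆ Finset.univ \ {i, k} := by
    intro x hx
    obtain ⟨j, -, rfl⟩ := Finset.mem_image.1 hx
    simp [hi j, h j]
  have h2 := Finset.card_le_card h1
  rw [Finset.card_image_of_injective _ hf, Finset.card_sdiff_of_subset (Finset.subset_univ _),
    Finset.card_pair hk.symm] at h2
  simp at h2
  have : 0 < n := by
    rcases n with _ | n
    · exact absurd (Subsingleton.elim (α := Fin 1) k i) hk
    · omega
  omega

lemma update_inj {n : ℕ} {f : Fin n → Fin (n+1)} (hf : Function.Injective f)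
    {i : Fin (n+1)} (hi : ∀ j, f j ≠ i) (j : Fin n) :
    Function.Injective (Function.update f j i) := by
  intro a b hab
  by_cases ha : a = j <;> by_cases hb : b = j
  · rw [ha, hb]
  · subst ha; simp [Function.update_of_ne hb] at hab; exact absurd hab.symm (hi b)
  · subst hb; simp [Function.update_of_ne ha] at hab; exact absurd hab (hi a)
  · rw [Function.update_of_ne ha, Function.update_of_ne hb] at hab; exact hf hab

lemma Wt_empty {n : ℕ} {H : Finset (Fin n)} {r : Fin n → Fin (n+1)} (hr : Function.Injective r) :
    Wt H r ∅ = Pig H r := by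
  apply Finset.Subset.antisymm Wt_subset
  intro i hi
  rw [mem_Pig] at hi
  rw [mem_Wt]
  by_cases h : ∃ j, r j = i
  · obtain ⟨j, hj⟩ := h
    obtain ⟨k, hk⟩ := exists_missing r
    have hjH : j ∈ H := by
      by_contra hjH
      exact hi j hjH hj
    refine ⟨Function.update r j k, ⟨update_inj hr hk j, ?_⟩, ?_, ?_⟩
    · intro a ha
      rw [Function.update_of_ne]
      rintro rfl; exact ha hjH
    · intro a h
      by_cases haj : a = j
      · subst haj
        simp at h
        exact hk a (hj.trans h.symm)
      · rw [Function.update_of_ne haj] at h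
        exact haj (hr (h.trans hj.symm))
    · simp [MSat]
  · push Not at h
    exact ⟨r, ⟨hr, fun _ _ => rfl⟩, h, by simp [MSat]⟩

/-- A clause of intermediate weight is wide. -/
lemma wide {n : ℕ} (hn : 0 < n) {H : Finset (Fin n)} {r : Fin n → Fin (n+1)}
    (M : Finset (Fin (n+1) × Fin n)) :
    (Wt H r M).card * (Pig H r \ Wt H r M).card ≤ (M ∩ (Pig H r ×ˢ H)).card := by
  classical
  have h0 : ∀ i, ∃ f, i ∈ Wt H r M → Ext H r f ∧ (∀ j, f j ≠ i) ∧ ¬ MSat f M := by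
    intro i
    by_cases hi : i ∈ Wt H r M
    · obtain ⟨f, hf⟩ := mem_Wt.1 hi
      exact ⟨f, fun _ => hf⟩
    · exact ⟨r, fun h => absurd h hi⟩
  choose F hF using h0
  have key : ∀ p : Fin (n+1) × Fin (n+1), ∃ j : Fin (n+1) × Fin n,
      p ∈ Wt H r M ×ˢ (Pig H r \ Wt H r M) →
      j.1 = p.1 ∧ j.2 ∈ H ∧ j ∈ M ∧ F p.1 j.2 = p.2 := by
    rintro ⟨i, k⟩
    by_cases hik : (i, k) ∈ Wt H r M ×ˢ (Pig H r \ Wt H r M)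
    · obtain ⟨hi, hk'⟩ := Finset.mem_product.1 hik
      obtain ⟨hk, hkW⟩ := Finset.mem_sdiff.1 hk'
      simp only at hi hk hkW
      obtain ⟨⟨hinj, hext⟩, hmiss, hns⟩ := hF i hi
      have hne : k ≠ i := by rintro rfl; exact hkW hi
      obtain ⟨j, hj⟩ := missing_unique hinj hmiss hne
      have hjH : j ∈ H := by
        by_contra hjH
        exact mem_Pig.1 hk j hjH ((hext j hjH).symm.trans hj)
      refine ⟨(i, j), fun _ => ⟨rfl, hjH, ?_, hj⟩⟩
      by_contra hnM
      apply hkW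
      rw [mem_Wt]
      refine ⟨Function.update (F i) j i, ⟨update_inj hinj hmiss j, ?_⟩, ?_, ?_⟩
      · intro a ha
        rw [Function.update_of_ne]
        · exact hext a ha
        · rintro rfl; exact ha hjH
      · intro a h
        by_cases haj : a = j
        · subst haj
          simp at h
          exact hne h.symm
        · rw [Function.update_of_ne haj] at h
          exact haj (hinj (h.trans hj.symm))
      · rintro ⟨a, ha⟩
        by_cases haj : a = j
        · subst haj
          simp at ha
          exact hnM ha
        · rw [Function.update_of_ne haj] at ha
          exact hns ⟨a, ha⟩
    · exact ⟨(i, ⟨0, hn⟩), fun h => absurd h hik⟩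
  choose G hG using key
  rw [← Finset.card_product]
  apply Finset.card_le_card_of_injOn G
  · intro p hp
    obtain ⟨h1, h2, h3, h4⟩ := hG p hp
    have hp1 := (Finset.mem_product.1 hp).1
    simp only [Finset.coe_inter, Finset.coe_product, Set.mem_inter_iff, Finset.mem_coe,
      Set.mem_prod]
    exact ⟨h3, h1 ▸ Wt_subset hp1, h2⟩
  · intro p hp q hq hpq
    obtain ⟨h1, h2, h3, h4⟩ := hG p hp
    obtain ⟨h1', h2', h3', h4'⟩ := hG q hq
    have e1 : p.1 = q.1 := by rw [← h1, ← h1', hpq]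
    refine Prod.ext e1 ?_
    rw [← h4, ← h4', hpq, e1]

open Classical in
/-- The clauses that are still alive and still large under the restriction `(H, r)`. -/
noncomputable def Alive {n : ℕ} (H : Finset (Fin n)) (r : Fin n → Fin (n+1))
    (L : Finset (Finset (Fin (n+1) × Fin n))) : Finset (Finset (Fin (n+1) × Fin n)) :=
  L.filter fun M => n * (n+1) ≤ 10 * (M ∩ (Pig H r ×ˢ H)).card ∧ ∀ j, j ∉ H → (r j, j) ∉ M

lemma reroute {n : ℕ} {H : Finset (Fin n)} {r : Fin n → Fin (n+1)} (hr : Function.Injective r)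
    {i : Fin (n+1)} {j : Fin n} (hi : i ∈ Pig H r) (hj : j ∈ H) :
    ∃ r', Ext H r r' ∧ r' j = i := by
  rw [mem_Pig] at hi
  by_cases h : ∃ j0, r j0 = i
  · obtain ⟨j0, hj0⟩ := h
    have hjH : j0 ∈ H := by
      by_contra hjH
      exact hi j0 hjH hj0
    refine ⟨r ∘ Equiv.swap j j0, ⟨hr.comp (Equiv.injective _), ?_⟩, ?_⟩
    · intro a ha
      have h1 : a ≠ j := by rintro rfl; exact ha hj
      have h2 : a ≠ j0 := by rintro rfl; exact ha hjH
      simp [Equiv.swap_apply_of_ne_of_ne h1 h2]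
    · simpa using hj0
  · push Not at h
    refine ⟨Function.update r j i, ⟨update_inj hr h j, ?_⟩, by simp⟩
    intro a ha
    rw [Function.update_of_ne]
    rintro rfl; exact ha hj

lemma greedy {n : ℕ} (L : Finset (Finset (Fin (n+1) × Fin n))) (k : ℕ) (hk : k ≤ n) :
    ∃ H : Finset (Fin n), ∃ r : Fin n → Fin (n+1), Function.Injective r ∧ Hᶜ.card = k ∧
      10 ^ k * (Alive H r L).card ≤ 9 ^ k * L.card := by
  classical
  induction k with
  | zero =>
    refine ⟨Finset.univ, Fin.castSucc, Fin.castSucc_injective n, by simp, ?_⟩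
    simp only [pow_zero, one_mul]
    exact Finset.card_le_card (Finset.filter_subset _ _)
  | succ k ih =>
    obtain ⟨H, r, hr, hH, hc⟩ := ih (by omega)
    -- some pair is in a tenth of the alive clauses
    have hpair : ∃ p ∈ Pig H r ×ˢ H,
        (Alive H r L).card ≤ 10 * ((Alive H r L).filter fun M => p ∈ M).card := by
      by_contra hcon
      push Not at hcon
      have hPcard := card_Pig (H := H) hr
      have hHcard := Finset.card_compl_add_card H
      rw [Fintype.card_fin] at hHcard
      have hne : (Pig H r ×ˢ H).Nonempty := by
        rw [Finset.nonempty_product, ← Finset.card_pos, ← Finset.card_pos]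
        omega
      have h1 : ∑ p ∈ Pig H r ×ˢ H, ((Alive H r L).filter fun M => p ∈ M).card
          = ∑ M ∈ Alive H r L, (M ∩ (Pig H r ×ˢ H)).card := by
        simp only [Finset.card_filter]
        rw [Finset.sum_comm]
        apply Finset.sum_congr rfl
        intro M _
        rw [← Finset.card_filter, Finset.inter_comm, Finset.filter_mem_eq_inter]
      have h2 : (Alive H r L).card * (n * (n+1)) ≤
          10 * ∑ M ∈ Alive H r L, (M ∩ (Pig H r ×ˢ H)).card := by
        rw [Finset.mul_sum, ← smul_eq_mul, ← Finset.sum_const]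
        apply Finset.sum_le_sum
        intro M hM
        exact (Finset.mem_filter.1 hM).2.1
      have h3 : ∑ p ∈ Pig H r ×ˢ H, 10 * ((Alive H r L).filter fun M => p ∈ M).card
          < ∑ p ∈ Pig H r ×ˢ H, (Alive H r L).card :=
        Finset.sum_lt_sum_of_nonempty hne hcon
      rw [← Finset.mul_sum, h1, Finset.sum_const, Finset.card_product, smul_eq_mul] at h3
      have h4 : (Pig H r).card * H.card ≤ (n+1) * n :=
        Nat.mul_le_mul (by omega) (by omega)
      nlinarith [Nat.mul_le_mul_right (Alive H r L).card h4]
    obtain ⟨⟨i, j⟩, hp, hcount⟩ := hpair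
    obtain ⟨hi, hj⟩ := Finset.mem_product.1 hp
    simp only at hi hj
    obtain ⟨r', ⟨hr', hext⟩, hij⟩ := reroute hr hi hj
    refine ⟨H.erase j, r', hr', ?_, ?_⟩
    · have h1 := Finset.card_compl_add_card H
      have h2 := Finset.card_compl_add_card (H.erase j)
      have h3 := Finset.card_erase_add_one hj
      omega
    · have hPsub : Pig (H.erase j) r' ⊆ Pig H r := by
        intro a ha
        rw [mem_Pig] at ha ⊢
        intro b hb
        rw [← hext b hb]
        exact ha b (fun h => hb (Finset.mem_of_mem_erase h))
      have hsub : Alive (H.erase j) r' L ⊆ (Alive H r L).filter fun M => ¬ (i, j) ∈ M := by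
        intro M hM
        obtain ⟨hML, hbig, hal⟩ := Finset.mem_filter.1 hM
        refine Finset.mem_filter.2 ⟨Finset.mem_filter.2 ⟨hML, hbig.trans ?_, ?_⟩, ?_⟩
        · apply Nat.mul_le_mul_left
          apply Finset.card_le_card
          exact Finset.inter_subset_inter_left
            (Finset.product_subset_product hPsub (Finset.erase_subset _ _))
        · intro b hb
          rw [← hext b hb]
          exact hal b (fun h => hb (Finset.mem_of_mem_erase h))
        · rw [← hij]
          exact hal j (by simp)
      have h1 := Finset.card_le_card hsub
      have h2 := Finset.card_filter_add_card_filter_not (s := Alive H r L) (fun M => (i, j) ∈ M)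
      have h3 : 10 * (Alive (H.erase j) r' L).card ≤ 9 * (Alive H r L).card := by omega
      calc 10 ^ (k+1) * (Alive (H.erase j) r' L).card
          = 10 ^ k * (10 * (Alive (H.erase j) r' L).card) := by ring
        _ ≤ 10 ^ k * (9 * (Alive H r L).card) := Nat.mul_le_mul_left _ h3
        _ = 9 * (10 ^ k * (Alive H r L).card) := by ring
        _ ≤ 9 * (9 ^ k * L.card) := Nat.mul_le_mul_left _ hc
        _ = 9 ^ (k+1) * L.card := by ring

/-- Haken's lower bound, for semantic derivations over critical assignments. -/
theorem haken {n : ℕ} (hn : 4 ≤ n) (l : ℕ) (M : ℕ → Finset (Fin (n+1) × Fin n))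
    (hstep : ∀ k < l, (∃ i, ∀ f, Function.Injective f → (∃ j, f j = i) → MSat f (M k)) ∨
      ∃ a < k, ∃ b < k, ∀ f, Function.Injective f → MSat f (M a) → MSat f (M b) → MSat f (M k))
    (hlast : ∃ k < l, M k = ∅) :
    10 ^ (n/4) ≤ 9 ^ (n/4) * (((Finset.range l).image M).erase ∅).card := by
  classical
  by_contra hcon
  push Not at hcon
  obtain ⟨H, r, hr, hH, hc⟩ := greedy (((Finset.range l).image M).erase ∅) (n/4)
    (by omega)
  have hzero : (Alive H r (((Finset.range l).image M).erase ∅)).card = 0 := by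
    by_contra h
    have : 10 ^ (n/4) * 1 ≤ 10 ^ (n/4) * (Alive H r (((Finset.range l).image M).erase ∅)).card :=
      Nat.mul_le_mul_left _ (by omega)
    omega
  rw [Finset.card_eq_zero] at hzero
  have hP := card_Pig (H := H) hr
  set m := (Pig H r).card with hm
  have hex : ∃ k, k < l ∧ m < 3 * (Wt H r (M k)).card := by
    obtain ⟨k, hk, hk0⟩ := hlast
    refine ⟨k, hk, ?_⟩
    rw [hk0, Wt_empty hr]
    omega
  obtain ⟨hkl, hkw⟩ := Nat.find_spec hex
  set k := Nat.find hex with hkdef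
  have hmin : ∀ a < k, 3 * (Wt H r (M a)).card ≤ m := by
    intro a ha
    have := Nat.find_min hex ha
    push Not at this
    exact this (by omega)
  have hup : 3 * (Wt H r (M k)).card ≤ 2 * m := by
    rcases hstep k hkl with ⟨i, hi⟩ | ⟨a, ha, b, hb, hab⟩
    · have : Wt H r (M k) ⊆ {i} := by
        intro i' hi'
        obtain ⟨f, hf, hmiss, hns⟩ := mem_Wt.1 hi'
        rw [Finset.mem_singleton]
        by_contra hne
        exact hns (hi f hf.1 (missing_unique hf.1 hmiss (Ne.symm hne)))
      have := Finset.card_le_card this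
      rw [Finset.card_singleton] at this
      omega
    · have : Wt H r (M k) ⊆ Wt H r (M a) ∪ Wt H r (M b) := by
        intro i' hi'
        obtain ⟨f, hf, hmiss, hns⟩ := mem_Wt.1 hi'
        rw [Finset.mem_union, mem_Wt, mem_Wt]
        by_contra hne
        push Not at hne
        exact hns (hab f hf.1 (hne.1 f hf hmiss) (hne.2 f hf hmiss))
      have := (Finset.card_le_card this).trans (Finset.card_union_le _ _)
      have h1 := hmin a ha
      have h2 := hmin b hb
      omega
  have hw := wide (by omega) (H := H) (r := r) (M k)
  have hsd : (Pig H r \ Wt H r (M k)).card + (Wt H r (M k)).card = m :=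
    Finset.card_sdiff_add_card_eq_card Wt_subset
  set w := (Wt H r (M k)).card with hwdef
  set u := (Pig H r \ Wt H r (M k)).card with hudef
  have hbig : n * (n+1) ≤ 10 * (M k ∩ (Pig H r ×ˢ H)).card := by
    have h1 : 3 * n + 4 ≤ 4 * m := by omega
    have h2 : 2 * (m * m) ≤ 9 * (w * u) := by
      obtain ⟨s, hs⟩ : ∃ s, 3 * w = m + s := ⟨3 * w - m, by omega⟩
      obtain ⟨t, ht⟩ : ∃ t, 3 * w + t = 2 * m := ⟨2 * m - 3 * w, by omega⟩
      have hst : 3 * u = m + t := by omega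
      have hm' : m = s + t := by omega
      have : 9 * (w * u) = (m + s) * (m + t) := by rw [← hs, ← hst]; ring
      rw [this, hm']
      nlinarith [Nat.zero_le (s*t)]
    nlinarith [Nat.mul_le_mul h1 h1]
  have hmem : M k ∈ Alive H r (((Finset.range l).image M).erase ∅) := by
    refine Finset.mem_filter.2 ⟨Finset.mem_erase.2 ⟨?_, Finset.mem_image.2
      ⟨k, Finset.mem_range.2 hkl, rfl⟩⟩, hbig, ?_⟩
    · intro h0
      rw [h0] at hbig
      simp at hbig
      omega
    · intro j hj hjM
      have hpos : 0 < w := by omega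
      obtain ⟨i, hi⟩ := Finset.card_pos.1 hpos
      obtain ⟨f, hf, hmiss, hns⟩ := mem_Wt.1 hi
      exact hns ⟨j, by rw [hf.2 j hj]; exact hjM⟩
  rw [hzero] at hmem
  exact absurd hmem (Finset.notMem_empty _)

end HakenPHP

/-! ## First-order semantics over the Boolean domain -/

namespace HakenPHP

/-- Term evaluation: `f₁` denotes true and every other function symbol false. -/
def evalT (v : ℕ → Bool) : FTerm → Bool
  | .var x => v x
  | .app k _ => decide (k = 1)

def evalA (P : ℕ → List Bool → Prop) (v : ℕ → Bool) (a : FAtom) : Prop :=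
  P a.p (a.args.map (evalT v))

def evalL (P : ℕ → List Bool → Prop) (v : ℕ → Bool) : FLit → Prop
  | .pos a => evalA P v a
  | .neg a => ¬ evalA P v a

def SatC (P : ℕ → List Bool → Prop) (C : FClause) : Prop :=
  ∀ v, ∃ l ∈ C, evalL P v l

lemma evalT_subst (v : ℕ → Bool) (σ : ℕ → FTerm) (t : FTerm) :
    evalT v (t.subst σ) = evalT (fun x => evalT v (σ x)) t := by
  cases t <;> simp [FTerm.subst, evalT]

lemma evalA_subst (P : ℕ → List Bool → Prop) (v : ℕ → Bool) (σ : ℕ → FTerm) (a : FAtom) :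
    evalA P v (a.subst σ) ↔ evalA P (fun x => evalT v (σ x)) a := by
  unfold evalA FAtom.subst
  simp only [List.map_map]
  have : (evalT v ∘ FTerm.subst σ) = evalT (fun x => evalT v (σ x)) := by
    funext t
    exact evalT_subst v σ t
  rw [this]

lemma evalL_subst (P : ℕ → List Bool → Prop) (v : ℕ → Bool) (σ : ℕ → FTerm) (l : FLit) :
    evalL P v (l.subst σ) ↔ evalL P (fun x => evalT v (σ x)) l := by
  cases l <;> simp [FLit.subst, evalL, evalA_subst]

lemma SatC.subst {P : ℕ → List Bool → Prop} {C : FClause} (h : SatC P C) (σ : ℕ → FTerm) :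
    SatC P (C.subst σ) := by
  intro v
  obtain ⟨l, hl, hv⟩ := h (fun x => evalT v (σ x))
  exact ⟨l.subst σ, Finset.mem_image_of_mem _ hl, (evalL_subst P v σ l).2 hv⟩

lemma SatC.factor {P : ℕ → List Bool → Prop} {C D : FClause} (h : SatC P C)
    (hD : IsFactor C D) : SatC P D := by
  obtain ⟨K, L, σ, -, -, -, -, -, rfl⟩ := hD
  exact h.subst σ

lemma evalL_opposite {P : ℕ → List Bool → Prop} {v : ℕ → Bool} {K L : FLit}
    (hs : K.isPos = !L.isPos) (ha : K.atom = L.atom) (hK : evalL P v K) (hL : evalL P v L) :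
    False := by
  cases K <;> cases L <;> simp_all [FLit.isPos, FLit.atom, evalL]

lemma SatC.resolvent {P : ℕ → List Bool → Prop} {C D E : FClause} (hC : SatC P C)
    (hD : SatC P D) (hE : IsResolvent C D E) : SatC P E := by
  obtain ⟨ρ, -, K, L, σ, -, -, -, hs, hu, rfl⟩ := hE
  intro v
  obtain ⟨k, hk, hkv⟩ := hC.subst σ v
  obtain ⟨l, hl, hlv⟩ := (hD.subst (renameSub ρ)).subst σ v
  by_cases h1 : k = K.subst σ
  · by_cases h2 : l = L.subst σ
    · exfalso
      subst h1 h2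
      refine evalL_opposite ?_ ?_ hkv hlv
      · cases K <;> cases L <;> simp_all [FLit.isPos, FLit.subst]
      · have := hu.1
        unfold Unifies at this
        cases K <;> cases L <;> simpa [FLit.atom, FLit.subst] using this
    · exact ⟨l, Finset.mem_union_right _ (Finset.mem_erase.2 ⟨h2, hl⟩), hlv⟩
  · exact ⟨k, Finset.mem_union_left _ (Finset.mem_erase.2 ⟨h1, hk⟩), hkv⟩

/-! ## The structures for `EPR(Ω_n)` -/

/-- Read off `y_{i+1,j+1}` from an argument vector. -/
def Yval (n : ℕ) (args : List Bool) (i j : ℕ) : Prop :=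
  args.getD ((Ylist n).idxOf (yv (i+1) (j+1))) false = true

/-- Interpretation of `p` and of the predicates for the `z`-variables. -/
def TP (n : ℕ) (p : ℕ) (args : List Bool) : Prop :=
  (p = 0 ∧ args = [true]) ∨
  (∃ i, p = zv (i+1) 0 0 + 1 ∧ ∃ j < n, Yval n args i j) ∨
  (∃ a b c, p = zv (a+1) (b+1) (c+1) + 1 ∧ ¬ (Yval n args a c ∧ Yval n args b c))

/-- The structure given by the critical assignment `f`. -/
def PP (n : ℕ) (f : Fin n → Fin (n+1)) (p : ℕ) (args : List Bool) : Prop :=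
  (∃ j : Fin n, p = xv (f j + 1) (j + 1) + 1) ∨ TP n p args

lemma xv_inj {a b c d : ℕ} : xv a b = xv c d ↔ a = c ∧ b = d := by
  simp [xv, Nat.pair_eq_pair]

lemma yv_inj {a b c d : ℕ} : yv a b = yv c d ↔ a = c ∧ b = d := by
  simp [yv, Nat.pair_eq_pair]

lemma zv_inj {a b c d e g : ℕ} : zv a b c = zv d e g ↔ a = d ∧ b = e ∧ c = g := by
  simp [zv, Nat.pair_eq_pair]

lemma xv_ne_zv {a b c d e : ℕ} : xv a b ≠ zv c d e := by
  simp [xv, zv, Nat.pair_eq_pair]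

lemma yv_ne_zv {a b c d e : ℕ} : yv a b ≠ zv c d e := by
  simp [yv, zv, Nat.pair_eq_pair]

lemma yv_ne_xv {a b c d : ℕ} : yv a b ≠ xv c d := by
  simp [yv, xv, Nat.pair_eq_pair]

lemma mem_Xlist {n x : ℕ} : x ∈ Xlist n ↔ ∃ i < n+1, ∃ j < n, xv (i+1) (j+1) = x := by
  simp [Xlist]

lemma mem_Ylist {n x : ℕ} : x ∈ Ylist n ↔ ∃ i < n+1, ∃ j < n, yv (i+1) (j+1) = x := by
  simp [Ylist]

lemma mem_Zlist {n x : ℕ} : x ∈ Zlist n ↔ (∃ i < n+1, zv (i+1) 0 0 = x) ∨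
    ∃ j < n, ∃ a < n+1, ∃ b < n+1, a < b ∧ zv (a+1) (b+1) (j+1) = x := by
  simp [Zlist]

lemma not_mem_Ylist {n x : ℕ} (h : x ∈ Zlist n ++ Xlist n) : x ∉ Ylist n := by
  rw [List.mem_append, mem_Zlist, mem_Xlist] at h
  rw [mem_Ylist]
  rintro ⟨i, -, j, -, rfl⟩
  rcases h with (⟨_, -, h⟩ | ⟨_, -, _, -, _, -, -, h⟩) | ⟨_, -, _, -, h⟩
  · exact yv_ne_zv h.symm
  · exact yv_ne_zv h.symm
  · exact yv_ne_xv h.symm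

lemma univBefore_Omega {n a : ℕ} (h : a ∉ Ylist n) : (OmegaF n).univBefore a = Ylist n := by
  have h1 : ∀ l1 l2 : List ℕ, a ∉ l1 →
      ((l1.map (fun x => (false, x)) ++ l2.map (fun x => (true, x))).takeWhile
        (fun p : Bool × ℕ => decide (p.2 ≠ a))).filterMap
        (fun p => if p.1 = false then some p.2 else none) = l1 := by
    intro l1 l2 ha
    induction l1 with
    | nil =>
      rw [List.filterMap_eq_nil_iff.2]
      intro p hp
      have := List.takeWhile_subset _ hp
      simp at this
      obtain ⟨x, -, rfl⟩ := this
      simp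
    | cons b l ih =>
      simp at ha
      have hb : b ≠ a := fun h => ha.1 h.symm
      have := ih ha.2
      simp [hb] at this ⊢
      exact this
  have := h1 (Ylist n) (Zlist n ++ Xlist n) h
  simpa [PCNF.univBefore, OmegaF] using this

lemma existB_Omega {n a : ℕ} : (OmegaF n).existB a = true ↔ a ∈ Zlist n ++ Xlist n := by
  simp [PCNF.existB, OmegaF]

lemma Ylist_ne_nil {n : ℕ} (hn : 1 ≤ n) : Ylist n ≠ [] := by
  intro h
  have : yv (0+1) (0+1) ∈ Ylist n := mem_Ylist.2 ⟨0, by omega, 0, by omega, rfl⟩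
  rw [h] at this
  simp at this

lemma eprAtom_exist {n a : ℕ} (hn : 1 ≤ n) (h : a ∈ Zlist n ++ Xlist n) :
    eprAtom (OmegaF n) a = ⟨a + 1, (Ylist n).map FTerm.var⟩ := by
  unfold eprAtom
  rw [if_pos (existB_Omega.2 h), univBefore_Omega (not_mem_Ylist h), if_neg (Ylist_ne_nil hn)]

lemma eprAtom_univ {n a : ℕ} (h : a ∈ Ylist n) :
    eprAtom (OmegaF n) a = ⟨0, [FTerm.var a]⟩ := by
  unfold eprAtom
  rw [if_neg]
  rw [existB_Omega]
  exact fun h' => not_mem_Ylist h' h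

lemma evalA_exist {n a : ℕ} (hn : 1 ≤ n) (h : a ∈ Zlist n ++ Xlist n)
    (P : ℕ → List Bool → Prop) (v : ℕ → Bool) :
    evalA P v (eprAtom (OmegaF n) a) ↔ P (a+1) ((Ylist n).map v) := by
  rw [eprAtom_exist hn h]
  unfold evalA
  simp only [List.map_map]
  rfl

lemma Yval_map {n i j : ℕ} (hi : i < n+1) (hj : j < n) (v : ℕ → Bool) :
    Yval n ((Ylist n).map v) i j ↔ v (yv (i+1) (j+1)) = true := by
  have hm : yv (i+1) (j+1) ∈ Ylist n := mem_Ylist.2 ⟨i, hi, j, hj, rfl⟩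
  have hlt := List.idxOf_lt_length_of_mem hm
  unfold Yval
  rw [List.getD_eq_getElem _ _ (by simpa using hlt)]
  simp

lemma evalA_y {n i j : ℕ} (hi : i < n+1) (hj : j < n) (f : Fin n → Fin (n+1)) (v : ℕ → Bool) :
    evalA (PP n f) v (eprAtom (OmegaF n) (yv (i+1) (j+1))) ↔ v (yv (i+1) (j+1)) = true := by
  rw [eprAtom_univ (mem_Ylist.2 ⟨i, hi, j, hj, rfl⟩)]
  simp [evalA, PP, TP, evalT]

lemma evalA_x {n : ℕ} (hn : 1 ≤ n) (f : Fin n → Fin (n+1)) (i : Fin (n+1)) (j : Fin n)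
    (v : ℕ → Bool) :
    evalA (PP n f) v (eprAtom (OmegaF n) (xv (i+1) (j+1))) ↔ f j = i := by
  rw [evalA_exist hn (List.mem_append_right _ (mem_Xlist.2 ⟨i, i.2, j, j.2, rfl⟩))]
  simp only [PP, TP, Nat.add_right_cancel_iff, xv_inj, xv_ne_zv, Nat.add_eq_zero_iff, false_and,
    exists_false, or_false, one_ne_zero, and_false]
  constructor
  · rintro ⟨j', h1, h2⟩
    rw [← Fin.ext_iff] at h1 h2
    rw [h2, h1]
  · rintro rfl
    exact ⟨j, rfl, rfl⟩

lemma evalA_z0 {n i : ℕ} (hn : 1 ≤ n) (f : Fin n → Fin (n+1)) (hi : i < n+1) (v : ℕ → Bool) :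
    evalA (PP n f) v (eprAtom (OmegaF n) (zv (i+1) 0 0)) ↔
      ∃ j < n, v (yv (i+1) (j+1)) = true := by
  rw [evalA_exist hn (List.mem_append_left _ (mem_Zlist.2 (Or.inl ⟨i, hi, rfl⟩)))]
  simp only [PP, TP, Nat.add_right_cancel_iff, zv_inj, xv_ne_zv.symm, Nat.add_eq_zero_iff,
    false_and, exists_false, one_ne_zero, and_false, false_or]
  constructor
  · rintro (⟨i', ⟨rfl, -⟩, j, hj, h⟩ | ⟨a, b, c, ⟨-, h, -⟩, -⟩)
    · exact ⟨j, hj, (Yval_map hi hj v).1 h⟩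
    · omega
  · rintro ⟨j, hj, h⟩
    exact Or.inl ⟨i, by simp, j, hj, (Yval_map hi hj v).2 h⟩

lemma evalA_z {n a b c : ℕ} (hn : 1 ≤ n) (f : Fin n → Fin (n+1)) (ha : a < n+1) (hb : b < n+1)
    (hab : a < b) (hc : c < n) (v : ℕ → Bool) :
    evalA (PP n f) v (eprAtom (OmegaF n) (zv (a+1) (b+1) (c+1))) ↔
      ¬ (v (yv (a+1) (c+1)) = true ∧ v (yv (b+1) (c+1)) = true) := by
  rw [evalA_exist hn (List.mem_append_left _ (mem_Zlist.2
    (Or.inr ⟨c, hc, a, ha, b, hb, hab, rfl⟩)))]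
  simp only [PP, TP, Nat.add_right_cancel_iff, zv_inj, xv_ne_zv.symm, Nat.add_eq_zero_iff,
    false_and, exists_false, one_ne_zero, and_false, false_or]
  rw [← Yval_map ha hc v, ← Yval_map hb hc v]
  constructor
  · rintro ⟨a', b', c', ⟨rfl, rfl, rfl⟩, h⟩
    exact h
  · intro h
    exact ⟨a, b, c, ⟨rfl, rfl, rfl⟩, h⟩

lemma php_total {n : ℕ} (v : ℕ → Bool) :
    (∃ i < n+1, ∀ j < n, v (yv (i+1) (j+1)) = false) ∨
    ∃ j < n, ∃ a < n+1, ∃ b < n+1, a < b ∧ v (yv (a+1) (j+1)) = true ∧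
      v (yv (b+1) (j+1)) = true := by
  by_contra hcon
  push Not at hcon
  obtain ⟨h1, h2⟩ := hcon
  have h1' : ∀ i : Fin (n+1), ∃ j : Fin n, v (yv (i+1) (j+1)) = true := by
    intro i
    obtain ⟨j, hj, h⟩ := h1 i i.2
    exact ⟨⟨j, hj⟩, by simpa using h⟩
  choose g hg using h1'
  obtain ⟨a, b, hab, heq⟩ := Fintype.exists_ne_map_eq_of_card_lt g (by simp)
  rcases lt_or_gt_of_ne hab with hlt | hlt
  · exact h2 (g a) (g a).2 a a.2 b b.2 hlt (hg a) (heq ▸ hg b)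
  · exact h2 (g a) (g a).2 b b.2 a a.2 hlt (heq ▸ hg b) (hg a)

lemma evalL_mem {P : ℕ → List Bool → Prop} {Φ : PCNF} {C : Clause} {v : ℕ → Bool} (l : Lit)
    (hl : l ∈ C) (h : evalL P v (eprLit Φ l)) : ∃ l ∈ eprClause Φ C, evalL P v l :=
  ⟨eprLit Φ l, Finset.mem_image_of_mem _ hl, h⟩

/-- Each initial clause is satisfied by all critical assignments that cover a suitable pigeon. -/
lemma input_sound {n : ℕ} (hn : 1 ≤ n) {C : FClause} (hC : C ∈ eprSet (OmegaF n)) :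
    ∃ i, ∀ f, Function.Injective f → (∃ j, f j = i) → SatC (PP n f) C := by
  rcases hC with hC | hC | hC
  · obtain ⟨D, hD, rfl⟩ := Finset.mem_image.1 (Finset.mem_coe.1 hC)
    have hD' : D ∈ TPHPcls n ∪ PHPcls n := hD
    rcases Finset.mem_union.1 hD' with hC | hC
    · refine ⟨0, fun f _ _ v => ?_⟩
      simp only [TPHPcls, Finset.mem_union, Finset.mem_singleton, List.mem_toFinset,
        List.mem_flatMap, List.mem_map, List.mem_range] at hC
      rcases hC with (rfl | ⟨i, hi, j, hj, rfl⟩) | ⟨j, hj, a, ha, b, hb, hC⟩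
      · rcases php_total (n := n) v with ⟨i, hi, h⟩ | ⟨j, hj, a, ha, b, hb, hab, h⟩
        · apply evalL_mem (Lit.neg (zv (i+1) 0 0))
          · simp only [List.mem_toFinset, List.mem_map]
            exact ⟨_, mem_Zlist.2 (Or.inl ⟨i, hi, rfl⟩), rfl⟩
          · simp only [eprLit, evalL, evalA_z0 hn f hi]
            rintro ⟨j, hj, h'⟩
            simp [h j hj] at h'
        · apply evalL_mem (Lit.neg (zv (a+1) (b+1) (j+1)))
          · simp only [List.mem_toFinset, List.mem_map]
            exact ⟨_, mem_Zlist.2 (Or.inr ⟨j, hj, a, ha, b, hb, hab, rfl⟩), rfl⟩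
          · simp only [eprLit, evalL, evalA_z hn f ha hb hab hj]
            exact fun h' => h' h
      · by_cases h : v (yv (i+1) (j+1)) = true
        · apply evalL_mem (Lit.pos (zv (i+1) 0 0)) (by simp)
          simp only [eprLit, evalL, evalA_z0 hn f hi]
          exact ⟨j, hj, h⟩
        · apply evalL_mem (Lit.neg (yv (i+1) (j+1))) (by simp)
          simp only [eprLit, evalL, evalA_y hi hj]
          exact h
      · by_cases hab : a < b
        · rw [if_pos hab] at hC
          by_cases h : v (yv (a+1) (j+1)) = true ∧ v (yv (b+1) (j+1)) = true
          · simp only [List.mem_cons, List.not_mem_nil, or_false] at hC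
            rcases hC with rfl | rfl
            · apply evalL_mem (Lit.pos (yv (a+1) (j+1))) (by simp)
              simp only [eprLit, evalL, evalA_y ha hj]
              exact h.1
            · apply evalL_mem (Lit.pos (yv (b+1) (j+1))) (by simp)
              simp only [eprLit, evalL, evalA_y hb hj]
              exact h.2
          · apply evalL_mem (Lit.pos (zv (a+1) (b+1) (j+1)))
            · simp only [List.mem_cons, List.not_mem_nil, or_false] at hC
              rcases hC with rfl | rfl <;> simp
            · simp only [eprLit, evalL, evalA_z hn f ha hb hab hj]
              exact h
        · simp [if_neg hab] at hC
    · simp only [PHPcls, Finset.mem_union, List.mem_toFinset,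
        List.mem_flatMap, List.mem_map, List.mem_filterMap, List.mem_range] at hC
      rcases hC with ⟨i, hi, rfl⟩ | ⟨j, hj, a, ha, b, hb, hC⟩
      · refine ⟨⟨i, hi⟩, fun f _ ⟨j, hj⟩ v => ?_⟩
        apply evalL_mem (Lit.pos (xv (i+1) (j+1)))
        · simp only [List.mem_toFinset, List.mem_map, List.mem_range]
          exact ⟨j, j.2, rfl⟩
        · simp only [eprLit, evalL]
          exact (evalA_x hn f ⟨i, hi⟩ j v).2 hj
      · refine ⟨0, fun f _ _ v => ?_⟩
        by_cases hab : a < b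
        · rw [if_pos hab] at hC
          simp only [Option.some.injEq] at hC
          subst hC
          by_cases h : f ⟨j, hj⟩ = ⟨a, ha⟩
          · apply evalL_mem (Lit.neg (xv (b+1) (j+1))) (by simp)
            simp only [eprLit, evalL]
            rw [evalA_x hn f ⟨b, hb⟩ ⟨j, hj⟩ v, h]
            simp only [Fin.mk.injEq]
            omega
          · apply evalL_mem (Lit.neg (xv (a+1) (j+1))) (by simp)
            simp only [eprLit, evalL]
            rw [evalA_x hn f ⟨a, ha⟩ ⟨j, hj⟩ v]
            exact h
        · simp [if_neg hab] at hC
  · subst hC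
    refine ⟨0, fun f _ _ v => ⟨_, Finset.mem_singleton_self _, ?_⟩⟩
    simp [evalL, evalA, PP, TP, evalT]
  · rw [Set.mem_singleton_iff] at hC
    subst hC
    refine ⟨0, fun f _ _ v => ⟨_, Finset.mem_singleton_self _, ?_⟩⟩
    simp [evalL, evalA, PP, TP, evalT]

/-! ## Monotone representation of first-order clauses -/

lemma TP_of_xv {n a b : ℕ} {args : List Bool} : ¬ TP n (xv a b + 1) args := by
  simp [TP, xv_ne_zv]

lemma PP_of_not_x {n p : ℕ} {f : Fin n → Fin (n+1)} {args : List Bool}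
    (h : ¬ ∃ (i : Fin (n+1)) (j : Fin n), p = xv (i+1) (j+1) + 1) :
    PP n f p args ↔ TP n p args := by
  unfold PP
  constructor
  · rintro (⟨j, hj⟩ | h')
    · exact absurd ⟨f j, j, hj⟩ h
    · exact h'
  · exact Or.inr

lemma PP_of_x {n : ℕ} {f : Fin n → Fin (n+1)} {args : List Bool} {i : Fin (n+1)} {j : Fin n} :
    PP n f (xv (i+1) (j+1) + 1) args ↔ f j = i := by
  simp only [PP, TP_of_xv, or_false, Nat.add_right_cancel_iff, xv_inj]
  constructor
  · rintro ⟨j', h1, h2⟩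
    rw [← Fin.ext_iff] at h1 h2
    rw [h2, h1]
  · rintro rfl
    exact ⟨j, rfl, rfl⟩

lemma local_witness {n : ℕ} (hn : 1 ≤ n) {f : Fin n → Fin (n+1)} {C : FClause}
    (h : SatC (PP n f) C) : ∃ j, ∀ g, g j = f j → SatC (PP n g) C := by
  by_cases hx : ∃ l ∈ C, ∃ v, (∃ (i : Fin (n+1)) (j : Fin n), l.atom.p = xv (i+1) (j+1) + 1) ∧
      evalL (PP n f) v l
  · obtain ⟨l, hl, v, ⟨i, j, hp⟩, hv⟩ := hx
    refine ⟨j, fun g hg w => ⟨l, hl, ?_⟩⟩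
    cases l with
    | pos a =>
      simp only [FLit.atom] at hp
      simp only [evalL, evalA, hp, PP_of_x] at hv ⊢
      rw [hg, hv]
    | neg a =>
      simp only [FLit.atom] at hp
      simp only [evalL, evalA, hp, PP_of_x] at hv ⊢
      rw [hg]
      exact hv
  · refine ⟨⟨0, hn⟩, fun g _ v => ?_⟩
    obtain ⟨l, hl, hv⟩ := h v
    refine ⟨l, hl, ?_⟩
    have hnx : ¬ ∃ (i : Fin (n+1)) (j : Fin n), l.atom.p = xv (i+1) (j+1) + 1 :=
      fun h' => hx ⟨l, hl, v, h', hv⟩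
    cases l with
    | pos a =>
      simp only [FLit.atom] at hnx
      simp only [evalL, evalA, PP_of_not_x hnx] at hv ⊢
      exact hv
    | neg a =>
      simp only [FLit.atom] at hnx
      simp only [evalL, evalA, PP_of_not_x hnx] at hv ⊢
      exact hv

open Classical in
/-- The monotone clause representing `C` on critical assignments. -/
noncomputable def Mon (n : ℕ) (C : FClause) : Finset (Fin (n+1) × Fin n) :=
  Finset.univ.filter fun q => ∀ g, Function.Injective g → g q.2 = q.1 → SatC (PP n g) C

lemma MSat_Mon {n : ℕ} (hn : 1 ≤ n) {f : Fin n → Fin (n+1)} (hf : Function.Injective f)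
    {C : FClause} : MSat f (Mon n C) ↔ SatC (PP n f) C := by
  classical
  constructor
  · rintro ⟨j, hj⟩
    exact (Finset.mem_filter.1 hj).2 f hf rfl
  · intro h
    obtain ⟨j, hj⟩ := local_witness hn h
    exact ⟨j, Finset.mem_filter.2 ⟨Finset.mem_univ _, fun g _ hg => hj g hg⟩⟩

lemma Mon_empty {n : ℕ} : Mon n ∅ = ∅ := by
  classical
  rw [Finset.eq_empty_iff_forall_notMem]
  rintro ⟨i, j⟩ h
  obtain ⟨g, hg, hij⟩ := reroute (H := Finset.univ) (Fin.castSucc_injective n) (i := i) (j := j)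
    (mem_Pig.2 (by simp)) (by simp)
  obtain ⟨l, hl, -⟩ := (Finset.mem_filter.1 h).2 g hg.1 hij (fun _ => false)
  simp at hl

lemma symSize_pos {C : FClause} (h : C ≠ ∅) : 1 ≤ FClause.symSize C := by
  obtain ⟨l, hl⟩ := Finset.nonempty_iff_ne_empty.2 h
  unfold FClause.symSize
  refine le_trans ?_ (Finset.single_le_sum (f := FLit.symSize) (fun _ _ => Nat.zero_le _) hl)
  cases l <;> simp [FLit.symSize, FAtom.symSize]

lemma card_le_r1Size (π : List FClause) :
    (π.toFinset.erase ∅).card ≤ r1Size π := by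
  induction π with
  | nil => simp [r1Size]
  | cons C π ih =>
    have h0 : r1Size (C :: π) = FClause.symSize C + r1Size π := by simp [r1Size]
    rw [List.toFinset_cons, h0]
    by_cases hC : C = ∅
    · subst hC
      rw [Finset.erase_insert_eq_erase]
      omega
    · rw [Finset.erase_insert_of_ne hC]
      have := Finset.card_insert_le C (π.toFinset.erase ∅)
      have := symSize_pos hC
      omega

theorem exp_bound {n : ℕ} (hn : 4 ≤ n) (π : List FClause)
    (h : R1Refutation (eprSet (OmegaF n)) π) : 10 ^ (n/4) ≤ 9 ^ (n/4) * r1Size π := by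
  classical
  obtain ⟨hval, hne, hlast⟩ := h
  have hpos : 0 < π.length := List.length_pos_iff.2 hne
  have hmain := haken hn π.length (fun k => Mon n π[k]!) ?_ ?_
  · refine hmain.trans (Nat.mul_le_mul_left _ (le_trans ?_ (card_le_r1Size π)))
    have hsub : (((Finset.range π.length).image (fun k => Mon n π[k]!)).erase ∅) ⊆
        (π.toFinset.erase ∅).image (Mon n) := by
      intro M hM
      obtain ⟨hM0, hM⟩ := Finset.mem_erase.1 hM
      obtain ⟨k, hk, rfl⟩ := Finset.mem_image.1 hM
      have hk' := Finset.mem_range.1 hk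
      refine Finset.mem_image.2 ⟨π[k]!, Finset.mem_erase.2 ⟨?_, ?_⟩, rfl⟩
      · intro h0
        simp only [h0] at hM0
        exact hM0 Mon_empty
      · rw [List.mem_toFinset, getElem!_pos π k hk']
        exact List.getElem_mem hk'
    exact (Finset.card_le_card hsub).trans Finset.card_image_le
  · intro k hk
    rcases hval k hk with hax | ⟨a, ha, hf⟩ | ⟨a, ha, b, hb, hr⟩
    · left
      obtain ⟨i, hi⟩ := input_sound (by omega) hax
      exact ⟨i, fun f hf hc => (MSat_Mon (by omega) hf).2 (hi f hf hc)⟩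
    · right
      refine ⟨a, ha, a, ha, fun f hinj h1 _ => ?_⟩
      rw [MSat_Mon (by omega) hinj] at h1 ⊢
      exact h1.factor hf
    · right
      refine ⟨a, ha, b, hb, fun f hinj h1 h2 => ?_⟩
      rw [MSat_Mon (by omega) hinj] at h1 h2 ⊢
      exact h1.resolvent h2 hr
  · refine ⟨π.length - 1, by omega, ?_⟩
    have : π[π.length - 1]! = ∅ := by
      rw [← hlast]
      cases π with
      | nil => simp at hpos
      | cons C π => simp [List.getLast!, List.getLast_eq_getElem]
    simp only [this]
    exact Mon_empty

lemma poly_mono (q : Polynomial ℕ) {a b : ℕ} (h : a ≤ b) : q.eval a ≤ q.eval b := by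
  simp only [Polynomial.eval_eq_sum, Polynomial.sum]
  exact Finset.sum_le_sum fun i _ => Nat.mul_le_mul_left _ (Nat.pow_le_pow_left h i)

open Filter Asymptotics in
lemma poly_lt_exp (q : Polynomial ℕ) : ∃ N, ∀ n ≥ N, q.eval n * 9 ^ (n/4) < 10 ^ (n/4) := by
  have h1 : (fun m : ℕ => ((q.eval (7 * m) : ℕ) : ℝ)) =o[atTop] fun m : ℕ => (10/9 : ℝ) ^ m := by
    have : (fun m : ℕ => ((q.eval (7 * m) : ℕ) : ℝ)) =
        fun m : ℕ => ∑ i ∈ q.support, ((q.coeff i : ℝ) * 7 ^ i) * (m : ℝ) ^ i := by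
      funext m
      simp only [Polynomial.eval_eq_sum, Polynomial.sum]
      push_cast
      refine Finset.sum_congr rfl fun i _ => ?_
      ring
    rw [this]
    apply IsLittleO.fun_sum
    intro i _
    exact (isLittleO_pow_const_const_pow_of_one_lt i (by norm_num)).const_mul_left _
  have h2 := h1.bound (c := 1/2) (by norm_num)
  obtain ⟨N, hN⟩ := eventually_atTop.1 h2
  refine ⟨4 * N + 4, fun n hn => ?_⟩
  have h3 := hN (n/4) (by omega)
  have h4 := poly_mono q (show n ≤ 7 * (n/4) by omega)
  rw [Real.norm_of_nonneg (by positivity), Real.norm_of_nonneg (by positivity)] at h3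
  refine lt_of_le_of_lt (Nat.mul_le_mul_right _ h4) ?_
  have h5 : ((q.eval (7 * (n/4)) : ℕ) : ℝ) * 9 ^ (n/4) < 10 ^ (n/4) := by
    have h9 : (0:ℝ) < 9 ^ (n/4) := by positivity
    rw [div_pow] at h3
    have h10 : (0:ℝ) < 10 ^ (n/4) := by positivity
    calc ((q.eval (7 * (n/4)) : ℕ) : ℝ) * 9 ^ (n/4)
        ≤ (1/2 * (10 ^ (n/4) / 9 ^ (n/4))) * 9 ^ (n/4) := by gcongr
      _ = 1/2 * 10 ^ (n/4) := by field_simp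
      _ < 10 ^ (n/4) := by linarith
  exact_mod_cast h5

end HakenPHP

/-- every R1 refutation of Ω′_n = EPR(Ω_n) ∪ {p(f₁), ¬p(f₀)}
has size superpolynomial in n. -/
theorem r1_epr_superpolynomial_on_Omega :
    ∀ q : Polynomial ℕ, ∃ N : ℕ, ∀ n : ℕ, N ≤ n →
      ∀ ρ : List FClause, R1Refutation (eprSet (OmegaF n)) ρ →
        q.eval n < r1Size ρ := by
  intro q
  obtain ⟨N, hN⟩ := HakenPHP.poly_lt_exp q
  refine ⟨N + 4, fun n hn ρ hρ => ?_⟩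
  have h1 := hN n (by omega)
  have h2 := HakenPHP.exp_bound (by omega) ρ hρ
  by_contra hcon
  push Not at hcon
  have h3 : 9 ^ (n/4) * r1Size ρ ≤ 9 ^ (n/4) * q.eval n := Nat.mul_le_mul_left _ hcon
  rw [Nat.mul_comm] at h1
  omega
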